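/- arXiv:2105.02333 — 2 statements merged into one kernel-verified Lean document; each statement's English description precedes it below -/
import Mathlib

section
/- Let (G, X, A) be an A/QI triple (X a δ-hyperbolic geodesic space, A ≤ G infinite finitely generated with quasi-isometrically embedded orbit Ax₀, and the G-action acylindrical along Ax₀). Let B ≤ G be an infinite subgroup, finitely generated, quasi-isometrically embedded by the action, and suppose A ∩ B is infinite. Then the orbit (A ∩ B)x₀ is quasi-convex in X; consequently the action of G on X is acylindrical along (A∩B)x₀ and (G, X, A∩B) is an A/QI triple. -/
open Metric Set

/-- The Gromov product `(x∣y)_w`. -/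
noncomputable def gprod {X : Type*} [MetricSpace X] (w x y : X) : ℝ :=
  (dist w x + dist w y - dist x y) / 2

/-- A geodesic metric space. -/
def IsGeodesicSpace (X : Type*) [MetricSpace X] : Prop :=
  ∀ x y : X, ∃ γ : ℝ → X, γ 0 = x ∧ γ (dist x y) = y ∧
    ∀ s ∈ Set.Icc (0:ℝ) (dist x y), ∀ t ∈ Set.Icc (0:ℝ) (dist x y),
      dist (γ s) (γ t) = |s - t|

/-- Word length with respect to a (symmetrized) generating set `S`. -/
noncomputable def wlen {G : Type*} [Group G] (S : Set G) (g : G) : ℕ :=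
  sInf {n | ∃ l : List G, l.length = n ∧ (∀ x ∈ l, x ∈ S ∨ x⁻¹ ∈ S) ∧ l.prod = g}

section

variable {G X : Type*} [Group G] [MetricSpace X] [MulAction G X]

/-- The orbit of a subgroup under the action at basepoint `x₀`. -/
def orbitOf (x₀ : X) (H : Subgroup G) : Set X := (fun h : G => h • x₀) '' (H : Set G)

/-- `K`-quasi-convexity of a subset of a metric space (via geodesic parametrizations). -/
def IsQuasiconvex (κ : ℝ) (K : Set X) : Prop :=
  ∀ a ∈ K, ∀ b ∈ K, ∀ γ : ℝ → X, γ 0 = a → γ (dist a b) = b →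
    (∀ s ∈ Set.Icc (0:ℝ) (dist a b), ∀ t ∈ Set.Icc (0:ℝ) (dist a b),
      dist (γ s) (γ t) = |s - t|) →
    ∀ u ∈ Set.Icc (0:ℝ) (dist a b), infDist (γ u) K ≤ κ

/-- The action of `G` is acylindrical along the subset `Y ⊆ X`. -/
def AcylindricalAlong (Y : Set X) : Prop :=
  ∀ ε : ℝ, 0 ≤ ε → ∃ R : ℝ, 0 < R ∧ ∃ M : ℕ, 0 < M ∧
    ∀ x ∈ Y, ∀ y ∈ Y, R ≤ dist x y →
      ({g : G | dist (g • x) x ≤ ε ∧ dist (g • y) y ≤ ε}).Finite ∧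
      ({g : G | dist (g • x) x ≤ ε ∧ dist (g • y) y ≤ ε}).ncard ≤ M

/-- `H` is finitely generated and quasi-isometrically embedded by the orbit map. -/
def QIEmbeddedByAction (x₀ : X) (H : Subgroup G) : Prop :=
  ∃ S : Set G, S.Finite ∧ Subgroup.closure S = H ∧
    ∃ C : ℝ, 1 ≤ C ∧ ∀ h ∈ H,
      (wlen S h : ℝ) / C - C ≤ dist (h • x₀) x₀ ∧ dist (h • x₀) x₀ ≤ C * (wlen S h) + C

end

section WordLength

variable {G : Type*} [Group G] {S : Set G}

theorem wlen_prod_le {l : List G} (hl : ∀ x ∈ l, x ∈ S ∨ x⁻¹ ∈ S) :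
    wlen S l.prod ≤ l.length :=
  Nat.sInf_le ⟨l, rfl, hl, rfl⟩

theorem exists_list_length_eq_wlen {g : G} (hg : g ∈ Subgroup.closure S) :
    ∃ l : List G, l.length = wlen S g ∧ (∀ x ∈ l, x ∈ S ∨ x⁻¹ ∈ S) ∧ l.prod = g := by
  rw [← Subgroup.mem_toSubmonoid, Subgroup.closure_toSubmonoid] at hg
  obtain ⟨l, hl, hp⟩ := Submonoid.exists_list_of_mem_closure hg
  exact Nat.sInf_mem (s := {n | ∃ l : List G, l.length = n ∧
    (∀ x ∈ l, x ∈ S ∨ x⁻¹ ∈ S) ∧ l.prod = g}) ⟨l.length, l, rfl, hl, hp⟩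

theorem list_prod_mem_closure {l : List G} (hl : ∀ x ∈ l, x ∈ S ∨ x⁻¹ ∈ S) :
    l.prod ∈ Subgroup.closure S :=
  Subgroup.list_prod_mem _ fun x hx => (hl x hx).elim
    (fun h => Subgroup.subset_closure h)
    (fun h => inv_mem_iff.1 (Subgroup.subset_closure h))

theorem finite_wlen_le (hS : S.Finite) (n : ℕ) :
    {g | g ∈ Subgroup.closure S ∧ wlen S g ≤ n}.Finite := by
  set T : Set G := {x | x ∈ S ∨ x⁻¹ ∈ S} with hT
  have hTf : T.Finite := hS.union (hS.preimage inv_injective.injOn)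
  have : Finite T := hTf
  refine ((List.finite_length_le T n).image fun l => (l.map Subtype.val).prod).subset ?_
  rintro g ⟨hg, hn⟩
  obtain ⟨l, hl, hlS, rfl⟩ := exists_list_length_eq_wlen hg
  lift l to List T using hlS
  refine ⟨l, ?_, rfl⟩
  rw [← hl, List.length_map] at hn
  exact hn

/-- A geodesic word gives a path of prefixes on which word length measures the difference of
indices. -/
theorem exists_geodesic_word_path {g : G} (hg : g ∈ Subgroup.closure S) :
    ∃ p : ℕ → G, p 0 = 1 ∧ p (wlen S g) = g ∧ (∀ i, p i ∈ Subgroup.closure S) ∧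
      (∀ i, wlen S ((p i)⁻¹ * p (i + 1)) ≤ 1) ∧
      ∀ i j, i ≤ j → j ≤ wlen S g → j - i ≤ wlen S ((p i)⁻¹ * p j) := by
  obtain ⟨l, hl, hlS, hp⟩ := exists_list_length_eq_wlen hg
  have htake : ∀ i, ∀ x ∈ l.take i, x ∈ S ∨ x⁻¹ ∈ S :=
    fun i x hx => hlS x (List.mem_of_mem_take hx)
  refine ⟨fun i => (l.take i).prod, by simp, by simp [← hl, hp],
    fun i => list_prod_mem_closure (htake i), fun i => ?_, fun i j hij hj => ?_⟩
  · rcases lt_or_ge i l.length with h | h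
    · have : (l.take i).prod⁻¹ * (l.take (i + 1)).prod = [l[i]].prod := by
        rw [List.take_succ_eq_append_getElem h, List.prod_append, inv_mul_cancel_left]
      dsimp only
      rw [this]
      refine wlen_prod_le (S := S) ?_
      intro x hx
      rw [List.mem_singleton.1 hx]
      exact hlS _ (List.getElem_mem h)
    · dsimp only
      rw [List.take_of_length_le h, List.take_of_length_le (by omega), inv_mul_cancel]
      exact (wlen_prod_le (S := S) (l := []) (by simp)).trans (by simp)
  · set g' := (l.take i).prod⁻¹ * (l.take j).prod with hg'
    have hmem : g' ∈ Subgroup.closure S :=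
      mul_mem (inv_mem (list_prod_mem_closure (htake i))) (list_prod_mem_closure (htake j))
    obtain ⟨m, hm, hmS, hmp⟩ := exists_list_length_eq_wlen hmem
    have hprod : (l.take i ++ m ++ l.drop j).prod = g := by
      rw [List.prod_append, List.prod_append, hmp, hg', mul_inv_cancel_left,
        List.prod_take_mul_prod_drop, hp]
    have := wlen_prod_le (S := S) (l := l.take i ++ m ++ l.drop j) (by
      intro x hx
      simp only [List.mem_append] at hx
      rcases hx with (hx | hx) | hx
      · exact htake i x hx
      · exact hmS x hx
      · exact hlS x (List.mem_of_mem_drop hx))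
    rw [hprod] at this
    simp only [List.length_append, List.length_take, List.length_drop] at this
    omega

end WordLength

section Morse

variable {X : Type*} [MetricSpace X] {δ : ℝ}

theorem gprod_comm (w x y : X) : gprod w x y = gprod w y x := by
  unfold gprod
  rw [dist_comm x y]
  ring

/-- Gromov products along a path decrease at most logarithmically in its length. -/
theorem le_gprod_of_path
    (hhyp : ∀ w x y z : X, min (gprod w x y) (gprod w y z) - δ ≤ gprod w x z)
    {w : X} {x : ℕ → X} {n : ℕ} {D L : ℝ} (hL : 0 ≤ L)
    (hD : ∀ i ≤ n, D ≤ dist w (x i)) (hstep : ∀ i < n, dist (x i) (x (i + 1)) ≤ L)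
    (k i j : ℕ) (hij : i ≤ j) (hj : j ≤ n) (hk : j ≤ i + 2 ^ k) :
    D - L / 2 - k * δ ≤ gprod w (x i) (x j) := by
  induction k generalizing i j with
  | zero =>
    rcases (show j = i ∨ j = i + 1 by simp at hk; omega) with rfl | rfl
    · have := hD j hj
      simp only [gprod, dist_self, Nat.cast_zero]
      linarith
    · have h1 := hD i (by omega)
      have h2 := hD (i + 1) hj
      have h3 := hstep i hj
      simp only [gprod, Nat.cast_zero]
      linarith
  | succ k ih =>
    rw [pow_succ] at hk
    have h1 := ih i (min j (i + 2 ^ k)) (by omega) (by omega) (by omega)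
    have h2 := ih (min j (i + 2 ^ k)) j (by omega) (by omega) (by omega)
    have h3 := hhyp w (x i) (x (min j (i + 2 ^ k))) (x j)
    have h4 := le_min h1 h2
    push_cast
    linarith

theorem exists_nat_bound_of_two_pow_le (P Q : ℝ) :
    ∃ N : ℕ, ∀ q : ℕ, (2 : ℝ) ^ q ≤ P + Q * q → q ≤ N := by
  have h0 := tendsto_pow_const_div_const_pow_of_one_lt 0 (one_lt_two (α := ℝ))
  have h1 := tendsto_pow_const_div_const_pow_of_one_lt 1 (one_lt_two (α := ℝ))
  have h := (h0.const_mul P).add (h1.const_mul Q)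
  simp only [mul_zero, add_zero] at h
  obtain ⟨N, hN⟩ := Filter.eventually_atTop.1 (h.eventually_lt_const one_pos)
  refine ⟨N, fun q hq => ?_⟩
  by_contra! hlt
  have h2 := hN q hlt.le
  have hpos : (0 : ℝ) < 2 ^ q := by positivity
  have : (P + Q * q) / 2 ^ q < 1 := by
    simpa only [pow_zero, pow_one, mul_one, mul_div_assoc', add_div] using h2
  rw [div_lt_one hpos] at this
  linarith

/-- Stability of quasi-geodesics: in a hyperbolic space a geodesic stays uniformly close to any
discrete quasi-geodesic with the same endpoints. -/
theorem geodesic_near_quasigeodesic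
    (hδ : 0 ≤ δ) (hhyp : ∀ w x y z : X, min (gprod w x y) (gprod w y z) - δ ≤ gprod w x z)
    {C L : ℝ} (hC : 0 ≤ C) (hL : 0 ≤ L) :
    ∃ κ : ℝ, 0 ≤ κ ∧ ∀ (x : ℕ → X) (n : ℕ),
      (∀ i < n, dist (x i) (x (i + 1)) ≤ L) →
      (∀ i j, i ≤ j → j ≤ n → (j : ℝ) - i ≤ C * dist (x i) (x j) + C) →
      ∀ (ℓ : ℝ) (γ : ℝ → X), 0 ≤ ℓ → γ 0 = x 0 → γ ℓ = x n →
      (∀ s ∈ Set.Icc (0 : ℝ) ℓ, ∀ t ∈ Set.Icc (0 : ℝ) ℓ, dist (γ s) (γ t) = |s - t|) →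
      ∀ u ∈ Set.Icc (0 : ℝ) ℓ, ∃ i ≤ n, dist (γ u) (x i) ≤ κ := by
  obtain ⟨N, hN⟩ := exists_nat_bound_of_two_pow_le
    (C * (6 * (L / 2 + 3 * δ + 1)) + C + 1) (C * 6 * δ)
  refine ⟨L / 2 + 3 * δ + N * δ + 1, by positivity, ?_⟩
  intro x n hstep hqi ℓ γ hℓ h0 h1 hγ
  set P : Set X := x '' Set.Iic n with hP
  have hPc : IsCompact P := ((Set.finite_Iic n).image x).isCompact
  have hPn : P.Nonempty := ⟨x 0, 0, by simp, rfl⟩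
  have hnear : ∀ y : X, ∃ i ≤ n, infDist y P = dist y (x i) := by
    intro y
    obtain ⟨_, ⟨i, hi, rfl⟩, h⟩ := hPc.exists_infDist_eq_dist hPn y
    exact ⟨i, hi, h⟩
  set E : Set ℝ := (fun t => infDist (γ t) P) '' Set.Icc 0 ℓ with hE
  have hEn : E.Nonempty := ⟨_, 0, ⟨le_rfl, hℓ⟩, rfl⟩
  have hEb : BddAbove E := by
    refine ⟨ℓ, ?_⟩
    rintro _ ⟨t, ht, rfl⟩
    have h2 : infDist (γ t) P ≤ dist (γ t) (x 0) :=
      infDist_le_dist_of_mem ⟨0, by simp, rfl⟩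
    rw [← h0, hγ t ht 0 ⟨le_rfl, hℓ⟩, sub_zero, abs_of_nonneg ht.1] at h2
    exact h2.trans ht.2
  obtain ⟨_, ⟨t, ht, rfl⟩, hlt⟩ := exists_lt_of_lt_csSup hEn (sub_one_lt (sSup E))
  have hmax : ∀ u ∈ Set.Icc (0 : ℝ) ℓ, infDist (γ u) P ≤ infDist (γ t) P + 1 := by
    intro u hu
    have := le_csSup hEb ⟨u, hu, rfl⟩
    dsimp only at hlt this
    linarith
  set w := γ t with hw
  set D := infDist w P with hDdef
  have hD0 : 0 ≤ D := infDist_nonneg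
  have hD : ∀ i ≤ n, D ≤ dist w (x i) := fun i hi =>
    infDist_le_dist_of_mem ⟨i, hi, rfl⟩
  -- a path point close to a geodesic point which is far from `w`, or to an endpoint
  have hside : ∀ s ∈ Set.Icc (0 : ℝ) ℓ,
      (|t - s| = 2 * (D + 1) ∨ (|t - s| ≤ 2 * (D + 1) ∧ (s = 0 ∨ s = ℓ))) →
      ∃ i ≤ n, dist (γ s) (x i) ≤ D + 1 ∧ D ≤ gprod w (γ s) (x i) := by
    intro s hs hcase
    have hend : ∀ i ≤ n, γ s = x i →
        ∃ i ≤ n, dist (γ s) (x i) ≤ D + 1 ∧ D ≤ gprod w (γ s) (x i) := by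
      intro i hi h
      refine ⟨i, hi, by rw [h, dist_self]; linarith, ?_⟩
      have := hD i hi
      simp only [gprod, h, dist_self]
      linarith
    rcases hcase with hfar | ⟨-, rfl | rfl⟩
    · obtain ⟨i, hi, hdi⟩ := hnear (γ s)
      have h2 := hmax s hs
      rw [hdi] at h2
      refine ⟨i, hi, h2, ?_⟩
      have h3 := hD i hi
      have h4 : dist w (γ s) = 2 * (D + 1) := by rw [hw, hγ t ht s hs, hfar]
      simp only [gprod, h4]
      linarith
    · exact hend 0 (by omega) h0
    · exact hend n le_rfl h1
  obtain ⟨s, hs, hst, hscase⟩ : ∃ s ∈ Set.Icc (0 : ℝ) ℓ, s ≤ t ∧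
      (|t - s| = 2 * (D + 1) ∨ (|t - s| ≤ 2 * (D + 1) ∧ (s = 0 ∨ s = ℓ))) := by
    rcases le_total (2 * (D + 1)) t with h | h
    · refine ⟨t - 2 * (D + 1), ⟨by linarith, by linarith [ht.2]⟩, by linarith, Or.inl ?_⟩
      rw [sub_sub_cancel, abs_of_nonneg (by linarith)]
    · refine ⟨0, ⟨le_rfl, hℓ⟩, ht.1, Or.inr ⟨?_, Or.inl rfl⟩⟩
      rw [sub_zero, abs_of_nonneg ht.1]
      exact h
  obtain ⟨r, hr, htr, hrcase⟩ : ∃ r ∈ Set.Icc (0 : ℝ) ℓ, t ≤ r ∧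
      (|t - r| = 2 * (D + 1) ∨ (|t - r| ≤ 2 * (D + 1) ∧ (r = 0 ∨ r = ℓ))) := by
    rcases le_total (t + 2 * (D + 1)) ℓ with h | h
    · refine ⟨t + 2 * (D + 1), ⟨by linarith [ht.1], h⟩, by linarith, Or.inl ?_⟩
      rw [sub_add_cancel_left, abs_neg, abs_of_nonneg (by linarith)]
    · refine ⟨ℓ, ⟨hℓ, le_rfl⟩, ht.2, Or.inr ⟨?_, Or.inr rfl⟩⟩
      rw [abs_sub_comm, abs_of_nonneg (by linarith [ht.2])]
      linarith
  have hsle : |t - s| ≤ 2 * (D + 1) := hscase.elim (fun h => h.le) (fun h => h.1)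
  have hrle : |t - r| ≤ 2 * (D + 1) := hrcase.elim (fun h => h.le) (fun h => h.1)
  obtain ⟨i, hi, hdi, hgi⟩ := hside s hs hscase
  obtain ⟨j, hj, hdj, hgj⟩ := hside r hr hrcase
  have hzero : gprod w (γ s) (γ r) = 0 := by
    simp only [gprod, hw]
    rw [hγ t ht s hs, hγ t ht r hr, hγ s hs r hr, abs_of_nonneg (sub_nonneg.2 hst),
      abs_of_nonpos (sub_nonpos.2 htr), abs_of_nonpos (by linarith)]
    ring
  have hdij : dist (x i) (x j) ≤ 6 * (D + 1) := by
    have h2 := dist_triangle4 (x i) (γ s) (γ r) (x j)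
    have h3 := dist_triangle (γ s) w (γ r)
    rw [dist_comm (γ s) w, hw, hγ t ht s hs, hγ t ht r hr] at h3
    rw [dist_comm (x i) (γ s)] at h2
    linarith
  have hpath : ∀ i j, i ≤ j → j ≤ n → dist (x i) (x j) ≤ 6 * (D + 1) →
      ∃ q : ℕ, (2 : ℝ) ^ q ≤ C * (6 * (D + 1)) + C + 1 ∧
        D - L / 2 - (q + 1) * δ ≤ gprod w (x i) (x j) := by
    intro i j hij hj hd
    refine ⟨Nat.log 2 (j - i + 1), ?_, ?_⟩
    · have h2 : 2 ^ Nat.log 2 (j - i + 1) ≤ j - i + 1 := Nat.pow_log_le_self 2 (by omega)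
      have h3 : ((2 ^ Nat.log 2 (j - i + 1) : ℕ) : ℝ) ≤ ((j - i + 1 : ℕ) : ℝ) := by
        exact_mod_cast h2
      push_cast [Nat.cast_sub hij] at h3
      have h4 := hqi i j hij hj
      have h5 := mul_le_mul_of_nonneg_left hd hC
      linarith
    · have h2 := Nat.lt_pow_succ_log_self one_lt_two (j - i + 1)
      have h3 := le_gprod_of_path hhyp hL hD hstep (Nat.log 2 (j - i + 1) + 1) i j hij hj
        (by omega)
      push_cast at h3
      exact h3
  obtain ⟨q, hq, hgq⟩ : ∃ q : ℕ, (2 : ℝ) ^ q ≤ C * (6 * (D + 1)) + C + 1 ∧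
      D - L / 2 - (q + 1) * δ ≤ gprod w (x i) (x j) := by
    rcases le_total i j with h | h
    · exact hpath i j h hj hdij
    · rw [gprod_comm]
      exact hpath j i h hi (by rwa [dist_comm])
  have hDq : D ≤ L / 2 + 3 * δ + q * δ := by
    have h2 := hhyp w (γ s) (x i) (x j)
    have h3 := hhyp w (γ s) (x j) (γ r)
    rw [hzero] at h3
    have hqδ : 0 ≤ (q + 1) * δ := by positivity
    rw [gprod_comm w (γ r)] at hgj
    have h4 : D - L / 2 - (q + 1) * δ ≤ gprod w (γ s) (x i) := by linarith
    have h5 := le_min h4 hgq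
    have h6 : D - L / 2 - (q + 1) * δ - δ ≤ gprod w (γ s) (x j) := by linarith
    have h7 : D - L / 2 - (q + 1) * δ - δ ≤ gprod w (x j) (γ r) := by linarith
    have h8 := le_min h6 h7
    linarith
  have hqN : q ≤ N := by
    refine hN q (hq.trans ?_)
    have := mul_le_mul_of_nonneg_left hDq hC
    linarith
  have hqN' : (q : ℝ) * δ ≤ N * δ := by gcongr
  intro u hu
  obtain ⟨k, hk, hdk⟩ := hnear (γ u)
  refine ⟨k, hk, ?_⟩
  rw [← hdk]
  linarith [hmax u hu]

end Morse

section Orbits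

variable {G X : Type*} [Group G] [MetricSpace X] [MulAction G X]

/-- Every geodesic from `x₀` to a point of the orbit `H x₀` lies in the `κ`-neighbourhood of the
orbit, with the nearby orbit points realized. -/
def OrbitGeodesicsNear (x₀ : X) (H : Subgroup G) (κ : ℝ) : Prop :=
  ∀ h ∈ H, ∀ (ℓ : ℝ) (γ : ℝ → X), 0 ≤ ℓ → γ 0 = x₀ → γ ℓ = h • x₀ →
    (∀ s ∈ Set.Icc (0 : ℝ) ℓ, ∀ t ∈ Set.Icc (0 : ℝ) ℓ, dist (γ s) (γ t) = |s - t|) →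
    ∀ u ∈ Set.Icc (0 : ℝ) ℓ, ∃ k ∈ H, dist (γ u) (k • x₀) ≤ κ

theorem OrbitGeodesicsNear.mono {x₀ : X} {H : Subgroup G} {κ κ' : ℝ}
    (h : OrbitGeodesicsNear x₀ H κ) (hκ : κ ≤ κ') : OrbitGeodesicsNear x₀ H κ' := by
  intro g hg ℓ γ hℓ h0 h1 hγ u hu
  obtain ⟨k, hk, hd⟩ := h g hg ℓ γ hℓ h0 h1 hγ u hu
  exact ⟨k, hk, hd.trans hκ⟩

theorem dist_smul_smul_eq (hiso : ∀ (g : G) (x y : X), dist (g • x) (g • y) = dist x y)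
    (g h : G) (x y : X) : dist (g • x) (h • y) = dist ((h⁻¹ * g) • x) y := by
  rw [← hiso h⁻¹, inv_smul_smul, smul_smul]

theorem QIEmbeddedByAction.orbitGeodesicsNear
    (hiso : ∀ (g : G) (x y : X), dist (g • x) (g • y) = dist x y)
    {δ : ℝ} (hδ : 0 ≤ δ)
    (hhyp : ∀ w x y z : X, min (gprod w x y) (gprod w y z) - δ ≤ gprod w x z)
    {x₀ : X} {H : Subgroup G} (hH : QIEmbeddedByAction x₀ H) :
    ∃ κ : ℝ, 0 ≤ κ ∧ OrbitGeodesicsNear x₀ H κ := by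
  obtain ⟨S, -, rfl, C, hC, hqi⟩ := hH
  obtain ⟨κ, hκ, hM⟩ := geodesic_near_quasigeodesic hδ hhyp (C := C * C) (L := C + C)
    (by positivity) (by positivity)
  refine ⟨κ, hκ, ?_⟩
  intro h hh ℓ γ hℓ h0 h1 hγ u hu
  obtain ⟨p, hp0, hpn, hpm, hp1, hpd⟩ := exists_geodesic_word_path hh
  have hstep : ∀ i < wlen S h, dist (p i • x₀) (p (i + 1) • x₀) ≤ C + C := by
    intro i _
    have h2 := (hqi _ (mul_mem (inv_mem (hpm i)) (hpm (i + 1)))).2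
    rw [dist_comm, dist_smul_smul_eq hiso]
    have h3 : (wlen S ((p i)⁻¹ * p (i + 1)) : ℝ) ≤ 1 := by exact_mod_cast hp1 i
    nlinarith
  have hlower : ∀ i j, i ≤ j → j ≤ wlen S h →
      (j : ℝ) - i ≤ C * C * dist (p i • x₀) (p j • x₀) + C * C := by
    intro i j hij hj
    have h2 := (hqi _ (mul_mem (inv_mem (hpm i)) (hpm j))).1
    have h3 : ((j - i : ℕ) : ℝ) ≤ wlen S ((p i)⁻¹ * p j) := by exact_mod_cast hpd i j hij hj
    rw [Nat.cast_sub hij] at h3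
    rw [dist_comm, dist_smul_smul_eq hiso]
    rw [sub_le_iff_le_add, div_le_iff₀ (by linarith)] at h2
    have h4 : dist (((p i)⁻¹ * p j) • x₀) x₀ * C ≤
        dist (((p i)⁻¹ * p j) • x₀) x₀ * (C * C) :=
      mul_le_mul_of_nonneg_left (by nlinarith) dist_nonneg
    linarith
  obtain ⟨i, -, hd⟩ := hM (fun i => p i • x₀) (wlen S h) hstep hlower ℓ γ hℓ
    (by simp [hp0, h0]) (by simp [hpn, h1]) hγ u hu
  exact ⟨p i, hpm i, hd⟩

theorem QIEmbeddedByAction.finite_dist_le {x₀ : X} {H : Subgroup G}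
    (hH : QIEmbeddedByAction x₀ H) (r : ℝ) : {h | h ∈ H ∧ dist (h • x₀) x₀ ≤ r}.Finite := by
  obtain ⟨S, hS, rfl, C, hC, hqi⟩ := hH
  refine (finite_wlen_le hS ⌊(r + C) * C⌋₊).subset ?_
  rintro h ⟨hh, hr⟩
  refine ⟨hh, Nat.le_floor ?_⟩
  rw [← div_le_iff₀ (by linarith)]
  linarith [(hqi h hh).1]

theorem OrbitGeodesicsNear.isQuasiconvex
    (hiso : ∀ (g : G) (x y : X), dist (g • x) (g • y) = dist x y)
    {x₀ : X} {H : Subgroup G} {κ : ℝ} (h : OrbitGeodesicsNear x₀ H κ) :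
    IsQuasiconvex κ (orbitOf x₀ H) := by
  rintro _ ⟨a, ha, rfl⟩ _ ⟨b, hb, rfl⟩ γ h0 h1 hγ u hu
  dsimp only at *
  obtain ⟨k, hk, hd⟩ := h (a⁻¹ * b) (mul_mem (inv_mem ha) hb) _ (fun t => a⁻¹ • γ t)
    dist_nonneg (by simp [h0]) (by simp [h1, mul_smul])
    (fun s hs t ht => by rw [hiso, hγ s hs t ht]) u hu
  have hmem : (a * k) • x₀ ∈ orbitOf x₀ H := ⟨a * k, mul_mem ha hk, rfl⟩
  refine (infDist_le_dist_of_mem hmem).trans ?_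
  rw [← hiso a, smul_inv_smul, smul_smul] at hd
  exact hd

/-- A discrete subgroup whose orbit is quasi-convex is finitely generated and quasi-isometrically
embedded. -/
theorem OrbitGeodesicsNear.qiEmbeddedByAction
    (hiso : ∀ (g : G) (x y : X), dist (g • x) (g • y) = dist x y) (hgeo : IsGeodesicSpace X)
    {x₀ : X} {H : Subgroup G} {κ : ℝ} (hκ : 0 ≤ κ) (h : OrbitGeodesicsNear x₀ H κ)
    (hfin : ∀ r : ℝ, {h | h ∈ H ∧ dist (h • x₀) x₀ ≤ r}.Finite) :
    QIEmbeddedByAction x₀ H := by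
  set S : Set G := {h | h ∈ H ∧ dist (h • x₀) x₀ ≤ 2 * κ + 1} with hS
  have hSH : Subgroup.closure S ≤ H := (Subgroup.closure_le H).2 fun g hg => hg.1
  have hword : ∀ g ∈ H, ∃ l : List G, (l.length : ℝ) ≤ dist (g • x₀) x₀ + 2 ∧
      (∀ x ∈ l, x ∈ S ∨ x⁻¹ ∈ S) ∧ l.prod = g := by
    intro g hg
    obtain ⟨γ, h0, h1, hγ⟩ := hgeo x₀ (g • x₀)
    set ℓ := dist x₀ (g • x₀) with hℓ
    have hℓ0 : 0 ≤ ℓ := dist_nonneg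
    have hpre : ∀ n : ℕ, ∀ u ∈ Set.Icc (0 : ℝ) ℓ, u ≤ n → ∀ k ∈ H,
        dist (γ u) (k • x₀) ≤ κ → ∃ l : List G, l.length = n + 1 ∧
          (∀ x ∈ l, x ∈ S ∨ x⁻¹ ∈ S) ∧ l.prod = k := by
      intro n
      induction n with
      | zero =>
        intro u hu hun k hk hd
        obtain rfl : u = 0 := le_antisymm (by simpa using hun) hu.1
        refine ⟨[k], rfl, ?_, by simp⟩
        intro x hx
        rw [List.mem_singleton.1 hx]
        rw [h0, dist_comm] at hd
        exact Or.inl ⟨hk, by linarith⟩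
      | succ n ih =>
        intro u hu hun k hk hd
        push_cast at hun
        have hv : max 0 (u - 1) ∈ Set.Icc (0 : ℝ) ℓ :=
          ⟨le_max_left _ _, max_le hℓ0 (by linarith [hu.2])⟩
        obtain ⟨k', hk', hd'⟩ := h g hg ℓ γ hℓ0 h0 h1 hγ _ hv
        obtain ⟨l, hl, hlS, hlp⟩ :=
          ih _ hv (max_le (by positivity) (by linarith)) k' hk' hd'
        refine ⟨l ++ [k'⁻¹ * k], by simp [hl], ?_, by simp [hlp]⟩
        intro x hx
        rcases List.mem_append.1 hx with hx | hx
        · exact hlS x hx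
        rw [List.mem_singleton.1 hx]
        refine Or.inl ⟨mul_mem (inv_mem hk') hk, ?_⟩
        rw [← dist_smul_smul_eq hiso]
        have h2 := dist_triangle4 (k • x₀) (γ u) (γ (max 0 (u - 1))) (k' • x₀)
        rw [hγ u hu _ hv, dist_comm (k • x₀) (γ u)] at h2
        have h3 : |u - max 0 (u - 1)| ≤ 1 := by
          have := hu.1
          rw [abs_le]
          constructor
          · linarith [max_le this (by linarith : u - 1 ≤ u)]
          · linarith [le_max_right 0 (u - 1)]
        linarith
    obtain ⟨l, hl, hlS, hlp⟩ := hpre ⌈ℓ⌉₊ ℓ ⟨hℓ0, le_rfl⟩ (Nat.le_ceil ℓ) g hg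
      (by rw [h1, dist_self]; exact hκ)
    refine ⟨l, ?_, hlS, hlp⟩
    rw [hl, dist_comm, ← hℓ]
    push_cast
    linarith [Nat.ceil_lt_add_one hℓ0]
  have hclosure : Subgroup.closure S = H := by
    refine le_antisymm hSH fun g hg => ?_
    obtain ⟨l, -, hlS, rfl⟩ := hword g hg
    exact list_prod_mem_closure hlS
  refine ⟨S, hfin _, hclosure, 2 * κ + 2, by linarith, fun g hg => ⟨?_, ?_⟩⟩
  · obtain ⟨l, hl, hlS, hlp⟩ := hword g hg
    have h2 : (wlen S g : ℝ) ≤ l.length := by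
      rw [← hlp]
      exact_mod_cast wlen_prod_le hlS
    have h3 : (wlen S g : ℝ) / (2 * κ + 2) ≤ dist (g • x₀) x₀ + (2 * κ + 2) := by
      refine (div_le_self (by positivity) (by linarith)).trans ?_
      linarith
    linarith
  · have hlist : ∀ l : List G, (∀ x ∈ l, x ∈ S ∨ x⁻¹ ∈ S) →
        dist (l.prod • x₀) x₀ ≤ (2 * κ + 2) * l.length := by
      intro l
      induction l with
      | nil => simp
      | cons a l ih =>
        intro hl
        have h2 := ih fun x hx => hl x (List.mem_cons_of_mem _ hx)
        have h3 : dist (a • x₀) x₀ ≤ 2 * κ + 1 := by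
          rcases hl a List.mem_cons_self with ha | ha
          · exact ha.2
          · rw [← hiso a⁻¹, inv_smul_smul, dist_comm]
            exact ha.2
        have h4 := dist_triangle ((a * l.prod) • x₀) (a • x₀) x₀
        rw [mul_smul, hiso] at h4
        rw [List.prod_cons, List.length_cons, mul_smul]
        push_cast
        linarith
    obtain ⟨l, hl, hlS, hlp⟩ := exists_list_length_eq_wlen (hclosure.symm ▸ hg)
    have := hlist l hlS
    rw [hlp, hl] at this
    linarith

theorem AcylindricalAlong.mono {Y Z : Set X} (h : AcylindricalAlong (G := G) Z) (hYZ : Y ⊆ Z) :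
    AcylindricalAlong (G := G) Y := by
  intro ε hε
  obtain ⟨R, hR, M, hM, hfin⟩ := h ε hε
  exact ⟨R, hR, M, hM, fun x hx y hy => hfin x (hYZ hx) y (hYZ hy)⟩

/-- Coarse coincidence sets along an acylindrical orbit are finite. -/
theorem AcylindricalAlong.exists_finite_coincidence
    (hiso : ∀ (g : G) (x y : X), dist (g • x) (g • y) = dist x y)
    {Y : Set X} (hY : AcylindricalAlong (G := G) Y) {κ : ℝ} (hκ : 0 ≤ κ) :
    ∃ R : ℝ, 0 < R ∧ ∀ x ∈ Y, ∀ y ∈ Y, R ≤ dist x y → ∀ x' y' : X,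
      {g : G | dist (g • x') x ≤ κ ∧ dist (g • y') y ≤ κ}.Finite := by
  obtain ⟨R, hR, M, -, hfin⟩ := hY (2 * κ) (by linarith)
  refine ⟨R, hR, fun x hx y hy hxy x' y' => ?_⟩
  rcases Set.eq_empty_or_nonempty {g : G | dist (g • x') x ≤ κ ∧ dist (g • y') y ≤ κ}
    with h | ⟨g₀, hg₀⟩
  · rw [h]
    exact Set.finite_empty
  refine ((hfin x hx y hy hxy).1.image (· * g₀)).subset fun g hg => ?_
  have key : ∀ z z' : X, dist (g • z') z ≤ κ → dist (g₀ • z') z ≤ κ →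
      dist ((g * g₀⁻¹) • z) z ≤ 2 * κ := by
    intro z z' h1 h2
    have h3 := dist_triangle ((g * g₀⁻¹) • z) (g • z') z
    rw [mul_smul, hiso, ← hiso g₀ (g₀⁻¹ • z), smul_inv_smul, dist_comm z] at h3
    rw [mul_smul]
    linarith
  exact ⟨g * g₀⁻¹, ⟨key x x' hg.1 hg₀.1, key y y' hg.2 hg₀.2⟩, by simp⟩

theorem OrbitGeodesicsNear.inf
    (hiso : ∀ (g : G) (x y : X), dist (g • x) (g • y) = dist x y)
    {x₀ : X} {A B : Subgroup G} {κ : ℝ} (hκ : 0 ≤ κ)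
    (hA : OrbitGeodesicsNear x₀ A κ) (hB : OrbitGeodesicsNear x₀ B κ)
    (hAfin : ∀ r : ℝ, {h | h ∈ A ∧ dist (h • x₀) x₀ ≤ r}.Finite)
    (hBfin : ∀ r : ℝ, {h | h ∈ B ∧ dist (h • x₀) x₀ ≤ r}.Finite)
    (hacyl : AcylindricalAlong (G := G) (orbitOf x₀ A)) :
    ∃ κ' : ℝ, 0 ≤ κ' ∧ OrbitGeodesicsNear x₀ (A ⊓ B) κ' := by
  obtain ⟨R, hR, hcoin⟩ := hacyl.exists_finite_coincidence hiso (κ := 2 * κ) (by linarith)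
  set T := R + 2 * κ with hT
  have hx₀ : x₀ ∈ orbitOf x₀ A := ⟨1, one_mem A, one_smul G x₀⟩
  set F : Set G := ⋃ α ∈ {h | h ∈ A ∧ dist (h • x₀) x₀ ≤ T + 2 * κ},
    ⋃ β ∈ {h | h ∈ B ∧ dist (h • x₀) x₀ ≤ T + 2 * κ},
      {g : G | R ≤ dist x₀ (α • x₀) ∧
        dist (g • x₀) x₀ ≤ 2 * κ ∧ dist (g • β • x₀) (α • x₀) ≤ 2 * κ} with hF
  have hFfin : F.Finite := by
    refine (hAfin _).biUnion fun α hα => (hBfin _).biUnion fun β _ => ?_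
    by_cases h : R ≤ dist x₀ (α • x₀)
    · exact (hcoin x₀ hx₀ _ ⟨α, hα.1, rfl⟩ h x₀ (β • x₀)).subset fun g hg => hg.2
    · exact Set.finite_empty.subset fun g hg => h hg.1
  have hrep : ∀ f : G, ∃ r : ℝ, ∀ a ∈ A, ∀ b ∈ B, f = a⁻¹ * b →
      ∃ c ∈ A, ∃ d ∈ B, f = c⁻¹ * d ∧ dist (c⁻¹ • x₀) x₀ ≤ r := by
    intro f
    by_cases h : ∃ c ∈ A, ∃ d ∈ B, f = c⁻¹ * d
    · obtain ⟨c, hc, d, hd, hf⟩ := h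
      exact ⟨_, fun _ _ _ _ _ => ⟨c, hc, d, hd, hf, le_rfl⟩⟩
    · exact ⟨0, fun a ha b hb hf => (h ⟨a, ha, b, hb, hf⟩).elim⟩
  choose r hr using hrep
  obtain ⟨r₀, hr₀⟩ := (hFfin.image r).bddAbove
  refine ⟨max (κ + r₀) T, le_max_of_le_right (by positivity), ?_⟩
  intro h hh ℓ γ hℓ h0 h1 hγ u hu
  rcases le_total ℓ (u + T) with hend | hmid
  · refine ⟨h, hh, le_max_of_le_right ?_⟩
    rw [← h1, hγ u hu ℓ ⟨hℓ, le_rfl⟩, abs_sub_comm, abs_of_nonneg (by linarith [hu.2])]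
    linarith
  have hT0 : 0 ≤ T := by positivity
  have hv : u + T ∈ Set.Icc (0 : ℝ) ℓ := ⟨by linarith [hu.1], hmid⟩
  have huv : dist (γ u) (γ (u + T)) = T := by
    rw [hγ u hu _ hv, sub_add_cancel_left, abs_neg, abs_of_nonneg hT0]
  obtain ⟨a, ha, hda⟩ := hA h hh.1 ℓ γ hℓ h0 h1 hγ u hu
  obtain ⟨b, hb, hdb⟩ := hB h hh.2 ℓ γ hℓ h0 h1 hγ u hu
  obtain ⟨a', ha', hda'⟩ := hA h hh.1 ℓ γ hℓ h0 h1 hγ _ hv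
  obtain ⟨b', hb', hdb'⟩ := hB h hh.2 ℓ γ hℓ h0 h1 hγ _ hv
  have hupper : ∀ c c' : G, dist (γ u) (c • x₀) ≤ κ → dist (γ (u + T)) (c' • x₀) ≤ κ →
      dist ((c⁻¹ * c') • x₀) x₀ ≤ T + 2 * κ := by
    intro c c' hc hc'
    rw [← dist_smul_smul_eq hiso]
    have h2 := dist_triangle4 (c' • x₀) (γ (u + T)) (γ u) (c • x₀)
    rw [dist_comm (c' • x₀) (γ (u + T)), dist_comm (γ (u + T)) (γ u), huv] at h2
    linarith
  have hmem : a⁻¹ * b ∈ F := by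
    simp only [hF, Set.mem_iUnion]
    refine ⟨a⁻¹ * a', ⟨mul_mem (inv_mem ha) ha', hupper a a' hda hda'⟩, b⁻¹ * b',
      ⟨mul_mem (inv_mem hb) hb', hupper b b' hdb hdb'⟩, ?_, ?_, ?_⟩
    · rw [dist_comm, ← dist_smul_smul_eq hiso]
      have h2 := dist_triangle4 (γ u) (a • x₀) (a' • x₀) (γ (u + T))
      rw [huv, dist_comm (a • x₀), dist_comm _ (γ (u + T))] at h2
      linarith
    · rw [← dist_smul_smul_eq hiso]
      have h2 := dist_triangle (b • x₀) (γ u) (a • x₀)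
      rw [dist_comm (b • x₀) (γ u)] at h2
      linarith
    · rw [smul_smul, mul_assoc, mul_inv_cancel_left, mul_smul, mul_smul, hiso]
      have h2 := dist_triangle (b' • x₀) (γ (u + T)) (a' • x₀)
      rw [dist_comm (b' • x₀) (γ (u + T))] at h2
      linarith
  obtain ⟨c, hc, d, hd, hcd, hdist⟩ := hr (a⁻¹ * b) a ha b hb rfl
  have heq : a * c⁻¹ = b * d⁻¹ := by
    have h2 : b = a * (c⁻¹ * d) := by rw [← hcd, mul_inv_cancel_left]
    rw [h2]
    group
  refine ⟨a * c⁻¹, ⟨A.mul_mem ha (A.inv_mem hc), heq ▸ B.mul_mem hb (B.inv_mem hd)⟩,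
    le_max_of_le_left ?_⟩
  have h2 := dist_triangle (γ u) (a • x₀) ((a * c⁻¹) • x₀)
  rw [mul_smul, hiso, dist_comm x₀] at h2
  rw [mul_smul]
  have h3 := hr₀ ⟨_, hmem, rfl⟩
  linarith

end Orbits

/-- Proposition 4.2: if `(G,X,A)` is an A/QI triple and `B` is an infinite
quasi-isometrically embedded subgroup with `A ∩ B` infinite, then the orbit `(A ∩ B)x₀` is
quasi-convex, the action is acylindrical along it, and `(G,X,A∩B)` is an A/QI triple. -/
theorem aqi_triple_intersection
    {G X : Type*} [Group G] [MetricSpace X] [MulAction G X]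
    (hiso : ∀ (g : G) (x y : X), dist (g • x) (g • y) = dist x y)
    (δ : ℝ) (hδ : 0 ≤ δ)
    (hhyp : ∀ w x y z : X, min (gprod w x y) (gprod w y z) - δ ≤ gprod w x z)
    (hgeo : IsGeodesicSpace X)
    (x₀ : X) (A B : Subgroup G)
    (hAinf : ((A : Set G)).Infinite) (hBinf : ((B : Set G)).Infinite)
    (hAqie : QIEmbeddedByAction x₀ A) (hBqie : QIEmbeddedByAction x₀ B)
    (hAacyl : AcylindricalAlong (G := G) (orbitOf x₀ A))
    (hABinf : (((A ⊓ B : Subgroup G) : Set G)).Infinite) :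
    (∃ κ : ℝ, 0 ≤ κ ∧ IsQuasiconvex κ (orbitOf x₀ (A ⊓ B))) ∧
    AcylindricalAlong (G := G) (orbitOf x₀ (A ⊓ B)) ∧
    QIEmbeddedByAction x₀ (A ⊓ B) := by
  obtain ⟨κA, hκA, hA⟩ := hAqie.orbitGeodesicsNear hiso hδ hhyp
  obtain ⟨κB, hκB, hB⟩ := hBqie.orbitGeodesicsNear hiso hδ hhyp
  obtain ⟨κ, hκ, hAB⟩ := (hA.mono (le_max_left κA κB)).inf hiso (le_max_of_le_left hκA)
    (hB.mono (le_max_right κA κB)) hAqie.finite_dist_le hBqie.finite_dist_le hAacyl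
  refine ⟨⟨κ, hκ, hAB.isQuasiconvex hiso⟩,
    hAacyl.mono (Set.image_mono fun g hg => hg.1), ?_⟩
  exact hAB.qiEmbeddedByAction hiso hgeo hκ fun r =>
    (hAqie.finite_dist_le r).subset fun g hg => ⟨hg.1.1, hg.2⟩
end

section
/- Let (G, X, H) be an A/QI triple with cone-off X̂ formed by coning all G-translates of Hx₀, and suppose γ is a τ₀-quasi-geodesic ray in X whose image in X̂ is bounded. Then the boundary point [γ] ∈ ∂X lies in ⋃_{g∈G} Λ(gHg⁻¹), the union of limit sets of the conjugates of H. -/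
open Metric Set Pointwise

section GromovProduct

variable {X : Type*} [MetricSpace X]

/-- The four-point hyperbolicity inequality with constant `δ`. -/
def FourPoint (X : Type*) [MetricSpace X] (δ : ℝ) : Prop :=
  ∀ w x y z : X, min (gprod w x y) (gprod w y z) - δ ≤ gprod w x z

/-- The restriction of `σ` to `[0, ℓ]` is an isometric embedding. -/
def IsGeodesicOn (σ : ℝ → X) (ℓ : ℝ) : Prop :=
  ∀ s ∈ Set.Icc (0:ℝ) ℓ, ∀ t ∈ Set.Icc (0:ℝ) ℓ, dist (σ s) (σ t) = |s - t|

/-- A `τ`-quasi-geodesic ray, not necessarily continuous. -/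
def IsQuasiGeodesicRay (τ : ℝ) (γ : ℝ → X) : Prop :=
  ∀ s ∈ Set.Ici (0:ℝ), ∀ t ∈ Set.Ici (0:ℝ),
    τ⁻¹ * |s - t| - τ ≤ dist (γ s) (γ t) ∧ dist (γ s) (γ t) ≤ τ * |s - t| + τ

lemma dist_sub_dist_le_gprod (w x y : X) : dist w x - dist x y ≤ gprod w x y := by
  unfold gprod
  linarith [dist_triangle w y x, dist_comm x y]

lemma gprod_le_gprod_add_dist_base (w w' x y : X) :
    gprod w x y ≤ gprod w' x y + dist w w' := by
  unfold gprod
  linarith [dist_triangle w w' x, dist_triangle w w' y]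

lemma gprod_le_gprod_add_dist_add_dist (w x y x' y' : X) :
    gprod w x' y' ≤ gprod w x y + dist x x' + dist y y' := by
  unfold gprod
  linarith [dist_triangle w x x', dist_triangle w y y', dist_triangle x x' y,
    dist_triangle x' y' y, dist_comm y y']

lemma gprod_self_geodesic {σ : ℝ → X} {ℓ : ℝ} (hσ : IsGeodesicOn σ ℓ) {a b c : ℝ}
    (ha : 0 ≤ a) (hab : a ≤ b) (hbc : b ≤ c) (hc : c ≤ ℓ) :
    gprod (σ b) (σ a) (σ c) = 0 := by
  have h1 := hσ b ⟨by linarith, by linarith⟩ a ⟨by linarith, by linarith⟩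
  have h2 := hσ b ⟨by linarith, by linarith⟩ c ⟨by linarith, by linarith⟩
  have h3 := hσ a ⟨by linarith, by linarith⟩ c ⟨by linarith, by linarith⟩
  rw [abs_of_nonneg (by linarith)] at h1
  rw [abs_of_nonpos (by linarith)] at h2 h3
  unfold gprod
  rw [h1, h2, h3]
  ring

lemma IsGeodesicOn.continuousOn {σ : ℝ → X} {ℓ : ℝ} (hσ : IsGeodesicOn σ ℓ) :
    ContinuousOn σ (Set.Icc 0 ℓ) := by
  have : LipschitzOnWith 1 σ (Set.Icc 0 ℓ) :=
    LipschitzOnWith.of_dist_le_mul fun s hs t ht => by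
      rw [hσ s hs t ht, Real.dist_eq]; simp
  exact this.continuousOn

/-- On a geodesic from `a` to `b` there is a point at distance at most `(a∣b)_z + 2δ` from `z`. -/
lemma exists_dist_geodesic_le {δ : ℝ} (hδ : FourPoint X δ) {σ : ℝ → X} {a b : X}
    (h0 : σ 0 = a) (h1 : σ (dist a b) = b) (hσ : IsGeodesicOn σ (dist a b)) (z : X) :
    ∃ v ∈ Set.Icc (0:ℝ) (dist a b), dist z (σ v) ≤ gprod z a b + 2 * δ := by
  have hv : gprod a z b ∈ Set.Icc (0:ℝ) (dist a b) := by
    unfold gprod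
    constructor <;>
      linarith [dist_triangle a z b, dist_triangle z a b, dist_triangle a b z, dist_comm a z,
        dist_comm b z]
  refine ⟨gprod a z b, hv, ?_⟩
  set v := gprod a z b with hvdef
  have hz := gprod_self_geodesic hσ le_rfl hv.1 hv.2 le_rfl
  have hpa := hσ v hv 0 ⟨le_rfl, dist_nonneg⟩
  have hpb := hσ v hv (dist a b) ⟨dist_nonneg, le_rfl⟩
  rw [h0, sub_zero, abs_of_nonneg hv.1] at hpa
  rw [h1, abs_of_nonpos (by linarith [hv.2])] at hpb
  have h4 := hδ (σ v) a z b
  rw [h0, h1] at hz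
  rw [hz] at h4
  have e1 : gprod (σ v) a z = (dist z (σ v) - gprod z a b) / 2 := by
    unfold gprod at hvdef ⊢
    rw [hpa, dist_comm (σ v) z, hvdef, dist_comm z a]
    linarith
  have e2 : gprod (σ v) z b = (dist z (σ v) - gprod z a b) / 2 := by
    unfold gprod at hvdef ⊢
    rw [hpb, dist_comm (σ v) z, hvdef, dist_comm z a]
    linarith
  rw [e1, e2, min_self] at h4
  linarith

lemma sub_le_gprod_of_pow_two_chain {δ : ℝ} (hδ : FourPoint X δ) (w : X) (c : ℝ) (k : ℕ)
    (p : ℕ → X) (hp : ∀ i < 2 ^ k, c ≤ gprod w (p i) (p (i + 1))) :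
    c - k * δ ≤ gprod w (p 0) (p (2 ^ k)) := by
  induction k generalizing p with
  | zero => simpa using hp 0 (by norm_num)
  | succ k ih =>
    have hk : 2 ^ (k + 1) = 2 ^ k + 2 ^ k := by ring
    have hleft := ih p fun i hi => hp i (by omega)
    have hright := ih (fun i => p (2 ^ k + i)) fun i hi => hp (2 ^ k + i) (by omega)
    have hsplit := hδ w (p 0) (p (2 ^ k)) (p (2 ^ k + 2 ^ k))
    have hmin := le_min hleft hright
    simp only [add_zero] at hmin
    rw [hk]
    push_cast
    linarith

end GromovProduct

section Morse

variable {X : Type*} [MetricSpace X]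

/-- A quantity that is at most logarithmic in itself is bounded. -/
lemma exists_bound_of_le_log {δ : ℝ} (hδ : 0 ≤ δ) (c α β : ℝ) (hα : 0 ≤ α) :
    ∃ D₀ : ℝ, ∀ (D : ℝ) (k : ℕ), (2:ℝ) ^ k ≤ α * D + β → D ≤ c + δ * k → D ≤ D₀ := by
  have hlim : Filter.Tendsto (fun k : ℕ => (α * c + β) * ((k:ℝ) ^ 0 / 2 ^ k) +
      α * δ * ((k:ℝ) ^ 1 / 2 ^ k)) Filter.atTop (nhds ((α * c + β) * 0 + α * δ * 0)) :=
    ((tendsto_pow_const_div_const_pow_of_one_lt 0 one_lt_two).const_mul _).add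
      ((tendsto_pow_const_div_const_pow_of_one_lt 1 one_lt_two).const_mul _)
  have hev := hlim.eventually (gt_mem_nhds (show (α * c + β) * 0 + α * δ * 0 < (1:ℝ) by norm_num))
  obtain ⟨k₀, hk₀⟩ := Filter.eventually_atTop.1 hev
  refine ⟨c + δ * k₀, fun D k hk hD => ?_⟩
  rcases le_total k k₀ with hkk | hkk
  · have : (k:ℝ) ≤ k₀ := by exact_mod_cast hkk
    nlinarith
  · exfalso
    have h := hk₀ k hkk
    have hpos : (0:ℝ) < 2 ^ k := by positivity
    have h' : (α * c + β) + α * δ * k < 2 ^ k := by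
      rw [← div_lt_one hpos]
      calc _ = _ := ?_
        _ < 1 := h
      ring
    nlinarith

lemma IsQuasiGeodesicRay.abs_sub_le {τ : ℝ} (hτ : 1 ≤ τ) {γ : ℝ → X}
    (hγ : IsQuasiGeodesicRay τ γ) {a b : ℝ} (ha : 0 ≤ a) (hb : 0 ≤ b) {r : ℝ}
    (h : dist (γ a) (γ b) ≤ r) : |a - b| ≤ τ * (r + τ) := by
  have h1 := (hγ a ha b hb).1
  have h2 : τ⁻¹ * |a - b| ≤ r + τ := by linarith
  rwa [inv_mul_le_iff₀ (by linarith)] at h2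

/-- If a segment of a quasi-geodesic avoids the `D`-ball about `w`, then its endpoints have Gromov
product at `w` at least `D` up to a logarithmic error. -/
lemma IsQuasiGeodesicRay.exists_sub_le_gprod {δ : ℝ} (hδ : FourPoint X δ) {τ : ℝ} (hτ : 1 ≤ τ)
    {γ : ℝ → X} (hγ : IsQuasiGeodesicRay τ γ) {t s : ℝ} (ht : 0 ≤ t) {a b : ℝ}
    (ha : a ∈ Set.Icc t s) (hb : b ∈ Set.Icc t s) (w : X) (D : ℝ)
    (hD : ∀ u ∈ Set.Icc t s, D ≤ dist w (γ u)) :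
    ∃ k : ℕ, (2:ℝ) ^ k ≤ 2 * (|a - b| + 1) ∧ D - 2 * τ - k * δ ≤ gprod w (γ a) (γ b) := by
  obtain ⟨n, hn1, hn2⟩ := exists_nat_pow_near (x := |a - b| + 1) (y := 2)
    (by linarith [abs_nonneg (a - b)]) one_lt_two
  refine ⟨n + 1, by rw [pow_succ]; linarith, ?_⟩
  have hpos : (0:ℝ) < 2 ^ (n + 1) := by positivity
  let q : ℕ → ℝ := fun i => a + (i / 2 ^ (n + 1)) * (b - a)
  have hq : ∀ i ≤ 2 ^ (n + 1), q i ∈ Set.Icc t s := fun i hi => by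
    have hi' : (i:ℝ) ≤ 2 ^ (n + 1) := by exact_mod_cast hi
    exact (convex_Icc t s).add_smul_sub_mem ha hb
      ⟨by positivity, (div_le_one hpos).2 hi'⟩
  have hstep : ∀ i < 2 ^ (n + 1), D - 2 * τ ≤ gprod w (γ (q i)) (γ (q (i + 1))) := by
    intro i hi
    have h1 := hq i hi.le
    have h2 := hq (i + 1) hi
    have hd := (hγ (q i) (ht.trans h1.1) (q (i + 1)) (ht.trans h2.1)).2
    have hsub : |q i - q (i + 1)| ≤ 1 := by
      have : q i - q (i + 1) = (a - b) / 2 ^ (n + 1) := by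
        simp only [q]; push_cast; ring
      rw [this, abs_div, abs_of_pos hpos, div_le_one hpos]
      linarith
    have := dist_sub_dist_le_gprod w (γ (q i)) (γ (q (i + 1)))
    have := hD _ h1
    nlinarith
  have h := sub_le_gprod_of_pow_two_chain hδ w (D - 2 * τ) (n + 1) (fun i => γ (q i)) hstep
  have q0 : q 0 = a := by simp [q]
  have q1 : q (2 ^ (n + 1)) = b := by
    simp only [q]; push_cast; rw [div_self hpos.ne']; ring
  simpa only [q0, q1] using h

/-- Geodesics with endpoints on a quasi-geodesic stay close to the quasi-geodesic. -/
lemma exists_forall_infDist_quasiGeodesic_le {δ : ℝ} (hδ0 : 0 ≤ δ) (hδ : FourPoint X δ) {τ : ℝ}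
    (hτ : 1 ≤ τ) :
    ∃ D₀ : ℝ, ∀ γ : ℝ → X, IsQuasiGeodesicRay τ γ → ∀ t s : ℝ, 0 ≤ t → t ≤ s →
      ∀ σ : ℝ → X, σ 0 = γ t → σ (dist (γ t) (γ s)) = γ s →
        IsGeodesicOn σ (dist (γ t) (γ s)) →
        ∀ v ∈ Set.Icc (0:ℝ) (dist (γ t) (γ s)), infDist (σ v) (γ '' Set.Icc t s) ≤ D₀ := by
  obtain ⟨D₀, hD₀⟩ := exists_bound_of_le_log hδ0 (2 * τ + 1 + 2 * δ) (12 * τ)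
    (2 * (τ * (2 + τ) + 1)) (by linarith)
  refine ⟨D₀, fun γ hγ t s ht hts σ h0 h1 hσ v' hv' => ?_⟩
  set ℓ := dist (γ t) (γ s) with hℓ
  set A := γ '' Set.Icc t s with hA
  have htA : γ t ∈ A := ⟨t, ⟨le_rfl, hts⟩, rfl⟩
  have hsA : γ s ∈ A := ⟨s, ⟨hts, le_rfl⟩, rfl⟩
  have hne : A.Nonempty := ⟨_, htA⟩
  have hcont : ContinuousOn (fun v => infDist (σ v) A) (Set.Icc 0 ℓ) :=
    (continuous_infDist_pt A).comp_continuousOn hσ.continuousOn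
  obtain ⟨v, hv, hmax⟩ := isCompact_Icc.exists_isMaxOn ⟨v', hv'⟩ hcont
  have hmax' : ∀ u ∈ Set.Icc (0:ℝ) ℓ, infDist (σ u) A ≤ infDist (σ v) A := fun u hu => hmax hu
  refine (hmax' v' hv').trans ?_
  set D := infDist (σ v) A with hD
  have hDnn : 0 ≤ D := infDist_nonneg
  have hfar : ∀ u ∈ Set.Icc t s, D ≤ dist (σ v) (γ u) := fun u hu =>
    infDist_le_dist_of_mem ⟨u, hu, rfl⟩
  obtain ⟨v₁, hv₁0, hv₁v, hv₁D, a, ha, hda, hga⟩ : ∃ v₁, 0 ≤ v₁ ∧ v₁ ≤ v ∧ v - v₁ ≤ 2 * D ∧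
      ∃ a ∈ Set.Icc t s, dist (σ v₁) (γ a) ≤ D + 1 ∧ D - 1 ≤ gprod (σ v) (σ v₁) (γ a) := by
    rcases le_total (v - 2 * D) 0 with h | h
    · refine ⟨0, le_rfl, hv.1, by linarith, t, ⟨le_rfl, hts⟩, ?_, ?_⟩
      · rw [h0, dist_self]; linarith
      · have := dist_sub_dist_le_gprod (σ v) (σ 0) (γ t)
        rw [h0, dist_self] at this
        rw [h0]
        linarith [hfar t ⟨le_rfl, hts⟩]
    · have hmem : v - 2 * D ∈ Set.Icc (0:ℝ) ℓ := ⟨h, by linarith [hv.2]⟩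
      obtain ⟨_, ⟨a, ha, rfl⟩, hda⟩ := (infDist_lt_iff hne).1
        (show infDist (σ (v - 2 * D)) A < D + 1 by linarith [hmax' _ hmem])
      refine ⟨v - 2 * D, h, by linarith, by linarith, a, ha, hda.le, ?_⟩
      have := dist_sub_dist_le_gprod (σ v) (σ (v - 2 * D)) (γ a)
      rw [hσ v hv _ hmem, abs_of_nonneg (by linarith)] at this
      linarith
  obtain ⟨v₂, hv₂ℓ, hv₂v, hv₂D, b, hb, hdb, hgb⟩ : ∃ v₂, v₂ ≤ ℓ ∧ v ≤ v₂ ∧ v₂ - v ≤ 2 * D ∧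
      ∃ b ∈ Set.Icc t s, dist (σ v₂) (γ b) ≤ D + 1 ∧ D - 1 ≤ gprod (σ v) (γ b) (σ v₂) := by
    have hcomm : ∀ x y : X, gprod (σ v) x y = gprod (σ v) y x := fun x y => by
      unfold gprod; rw [dist_comm x y]; ring
    rcases le_total ℓ (v + 2 * D) with h | h
    · refine ⟨ℓ, le_rfl, hv.2, by linarith, s, ⟨hts, le_rfl⟩, ?_, ?_⟩
      · rw [h1, dist_self]; linarith
      · have := dist_sub_dist_le_gprod (σ v) (γ s) (σ ℓ)
        rw [h1, dist_self] at this
        rw [h1]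
        linarith [hfar s ⟨hts, le_rfl⟩]
    · have hmem : v + 2 * D ∈ Set.Icc (0:ℝ) ℓ := ⟨by linarith [hv.1], h⟩
      obtain ⟨_, ⟨b, hb, rfl⟩, hdb⟩ := (infDist_lt_iff hne).1
        (show infDist (σ (v + 2 * D)) A < D + 1 by linarith [hmax' _ hmem])
      refine ⟨v + 2 * D, h, by linarith, by linarith, b, hb, hdb.le, ?_⟩
      have := dist_sub_dist_le_gprod (σ v) (σ (v + 2 * D)) (γ b)
      rw [hσ v hv _ hmem, abs_of_nonpos (by linarith)] at this
      rw [hcomm]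
      linarith
  obtain ⟨k, hk, hgk⟩ := hγ.exists_sub_le_gprod hδ hτ ht ha hb (σ v) D hfar
  have hd12 : dist (σ v₁) (σ v₂) ≤ 4 * D := by
    rw [hσ v₁ ⟨hv₁0, by linarith⟩ v₂ ⟨by linarith, hv₂ℓ⟩, abs_of_nonpos (by linarith)]
    linarith
  have hdab : dist (γ a) (γ b) ≤ 6 * D + 2 := by
    linarith [dist_triangle4 (γ a) (σ v₁) (σ v₂) (γ b), dist_comm (γ a) (σ v₁)]
  have hab := hγ.abs_sub_le hτ (ht.trans ha.1) (ht.trans hb.1) hdab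
  refine hD₀ D k (by nlinarith) ?_
  have hzero := gprod_self_geodesic hσ hv₁0 hv₁v hv₂v hv₂ℓ
  have hkδ : 0 ≤ k * δ := by positivity
  have hleft : D - 2 * τ - 1 - k * δ - δ ≤ gprod (σ v) (σ v₁) (γ b) := by
    have := hδ (σ v) (σ v₁) (γ a) (γ b)
    have := le_min (c := D - 2 * τ - 1 - k * δ) (by linarith : _ ≤ gprod (σ v) (σ v₁) (γ a))
      (by linarith : _ ≤ gprod (σ v) (γ a) (γ b))
    linarith
  have := hδ (σ v) (σ v₁) (γ b) (σ v₂)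
  have := le_min (c := D - 2 * τ - 1 - k * δ - δ) hleft
    (by linarith : _ ≤ gprod (σ v) (γ b) (σ v₂))
  linarith

/-- Stability of quasi-geodesics, in terms of Gromov products. -/
lemma exists_forall_gprod_quasiGeodesic_le {δ : ℝ} (hδ0 : 0 ≤ δ) (hδ : FourPoint X δ)
    (hgeo : IsGeodesicSpace X) {τ : ℝ} (hτ : 1 ≤ τ) :
    ∃ M : ℝ, 0 ≤ M ∧ ∀ γ : ℝ → X, IsQuasiGeodesicRay τ γ → ∀ t u s : ℝ, 0 ≤ t → t ≤ u → u ≤ s →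
      gprod (γ u) (γ t) (γ s) ≤ M := by
  obtain ⟨D₀, hD₀⟩ := exists_forall_infDist_quasiGeodesic_le hδ0 hδ hτ
  suffices h : ∃ M : ℝ, ∀ γ : ℝ → X, IsQuasiGeodesicRay τ γ → ∀ t u s : ℝ, 0 ≤ t → t ≤ u →
      u ≤ s → gprod (γ u) (γ t) (γ s) ≤ M by
    obtain ⟨M, hM⟩ := h
    exact ⟨max M 0, le_max_right _ _, fun γ hγ t u s h1 h2 h3 =>
      (hM γ hγ t u s h1 h2 h3).trans (le_max_left _ _)⟩
  refine ⟨τ * (τ * (2 * (D₀ + 2) + τ)) + τ + (D₀ + 2), fun γ hγ t u s ht htu hus => ?_⟩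
  obtain ⟨σ, h0, h1, hσ⟩ := hgeo (γ t) (γ s)
  have hσ : IsGeodesicOn σ (dist (γ t) (γ s)) := hσ
  have hclose := hD₀ γ hγ t s ht (htu.trans hus) σ h0 h1 hσ
  set ℓ := dist (γ t) (γ s) with hℓ
  set A := γ '' Set.Icc t u with hA
  set B := γ '' Set.Icc u s with hB
  have hAne : A.Nonempty := ⟨_, t, ⟨le_rfl, htu⟩, rfl⟩
  have hBne : B.Nonempty := ⟨_, s, ⟨hus, le_rfl⟩, rfl⟩
  have hcont : ContinuousOn (fun v => infDist (σ v) A - infDist (σ v) B) (Set.Icc 0 ℓ) :=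
    ((continuous_infDist_pt A).comp_continuousOn hσ.continuousOn).sub
      ((continuous_infDist_pt B).comp_continuousOn hσ.continuousOn)
  have hzero : (0:ℝ) ∈ Set.Icc (infDist (σ 0) A - infDist (σ 0) B)
      (infDist (σ ℓ) A - infDist (σ ℓ) B) := by
    have e1 : infDist (σ 0) A = 0 := infDist_zero_of_mem (h0 ▸ ⟨t, ⟨le_rfl, htu⟩, rfl⟩)
    have e2 : infDist (σ ℓ) B = 0 := infDist_zero_of_mem (h1 ▸ ⟨s, ⟨hus, le_rfl⟩, rfl⟩)
    rw [e1, e2]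
    constructor
    · linarith [infDist_nonneg (x := σ 0) (s := B)]
    · linarith [infDist_nonneg (x := σ ℓ) (s := A)]
  obtain ⟨v, hv, hveq⟩ := intermediate_value_Icc dist_nonneg hcont hzero
  have hAB : infDist (σ v) A = infDist (σ v) B := sub_eq_zero.1 hveq
  obtain ⟨_, ⟨c, hc, rfl⟩, hdc⟩ := (infDist_lt_iff (s := γ '' Set.Icc t s)
    ⟨_, t, ⟨le_rfl, htu.trans hus⟩, rfl⟩).1
    (show infDist (σ v) (γ '' Set.Icc t s) < D₀ + 1 by linarith [hclose v hv])
  have hsmall : infDist (σ v) A < D₀ + 2 := by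
    rcases le_total c u with h | h
    · linarith [infDist_le_dist_of_mem (x := σ v) (s := A) ⟨c, ⟨hc.1, h⟩, rfl⟩]
    · rw [hAB]
      linarith [infDist_le_dist_of_mem (x := σ v) (s := B) ⟨c, ⟨h, hc.2⟩, rfl⟩]
  obtain ⟨_, ⟨a, ha, rfl⟩, hda⟩ := (infDist_lt_iff hAne).1 hsmall
  obtain ⟨_, ⟨b, hb, rfl⟩, hdb⟩ := (infDist_lt_iff hBne).1 (hAB ▸ hsmall)
  have hab := hγ.abs_sub_le hτ (ht.trans ha.1) (ht.trans (htu.trans hb.1))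
    (show dist (γ a) (γ b) ≤ 2 * (D₀ + 2) by
      linarith [dist_triangle (γ a) (σ v) (γ b), dist_comm (γ a) (σ v)])
  rw [abs_of_nonpos (by linarith [ha.2, hb.1])] at hab
  have hua := (hγ u (ht.trans htu) a (ht.trans ha.1)).2
  rw [abs_of_nonneg (by linarith [ha.2])] at hua
  have hbase := gprod_le_gprod_add_dist_base (γ u) (σ v) (γ t) (γ s)
  have hgz := gprod_self_geodesic hσ le_rfl hv.1 hv.2 le_rfl
  rw [h0, h1] at hgz
  have := dist_triangle (γ u) (γ a) (σ v)
  rw [dist_comm (γ a)] at this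
  nlinarith [ha.2, hb.1]

end Morse

section ConeOff

variable {G X : Type*} [Group G] [MetricSpace X] [MulAction G X]

/-- `ConeChain Y n x y ℓ`: one can go from `x` to `y` using `n` jumps inside translates of `Y` and
walking a total distance at most `ℓ` in between. -/
inductive ConeChain (G : Type*) {X : Type*} [Group G] [MetricSpace X] [MulAction G X] (Y : Set X) :
    ℕ → X → X → ℝ → Prop
  | walk {x y : X} {ℓ : ℝ} (h : dist x y ≤ ℓ) : ConeChain G Y 0 x y ℓ
  | jump {n : ℕ} {x u v y : X} {ℓ ℓ' : ℝ} (g : G) (h : ConeChain G Y n x u ℓ)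
      (hu : u ∈ g • Y) (hv : v ∈ g • Y) (hy : dist v y ≤ ℓ') : ConeChain G Y (n + 1) x y (ℓ + ℓ')

namespace ConeChain

variable {Y : Set X}

lemma nonneg {n : ℕ} {x y : X} {ℓ : ℝ} (h : ConeChain G Y n x y ℓ) : 0 ≤ ℓ := by
  induction h with
  | walk h => exact dist_nonneg.trans h
  | jump g _ _ _ hy ih => exact add_nonneg ih (dist_nonneg.trans hy)

lemma trans {n m : ℕ} {x y z : X} {ℓ ℓ' : ℝ} (h : ConeChain G Y n x y ℓ)
    (h' : ConeChain G Y m y z ℓ') : ConeChain G Y (n + m) x z (ℓ + ℓ') := by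
  induction h' with
  | walk h' =>
    cases h with
    | walk h => exact walk ((dist_triangle _ _ _).trans (add_le_add h h'))
    | jump g h hu hv hy =>
      rw [add_zero, add_assoc]
      exact jump g h hu hv ((dist_triangle _ _ _).trans (add_le_add hy h'))
  | jump g _ hu hv hy ih =>
    rw [← add_assoc ℓ]
    exact jump g (ih h) hu hv hy

lemma symm {n : ℕ} {x y : X} {ℓ : ℝ} (h : ConeChain G Y n x y ℓ) : ConeChain G Y n y x ℓ := by
  induction h with
  | walk h => exact walk (by rwa [dist_comm])
  | @jump n x u v y ℓ ℓ' g _ hu hv hy ih =>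
    have h1 : ConeChain G Y 1 y u (ℓ' + 0) :=
      jump g (walk (by rwa [dist_comm])) hv hu (dist_self u).le
    have := h1.trans ih
    rwa [add_zero, add_comm ℓ', add_comm 1 n] at this

end ConeChain

/-- A pseudometric which is maximal among those dominated by `dist` and giving diameter at most `1`
to every translate of `Y` is realised by chains. -/
lemma exists_coneChain_of_lt {Y : Set X} {dhat : X → X → ℝ}
    (dhat_max : ∀ ρ : X → X → ℝ, (∀ x, ρ x x = 0) → (∀ x y, ρ x y = ρ y x) →
      (∀ x y z, ρ x z ≤ ρ x y + ρ y z) → (∀ x y, ρ x y ≤ dist x y) →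
      (∀ (g : G), ∀ u ∈ g • Y, ∀ v ∈ g • Y, ρ u v ≤ 1) → ∀ x y, ρ x y ≤ dhat x y)
    {x y : X} {R : ℝ} (hR : dhat x y < R) :
    ∃ (n : ℕ) (ℓ : ℝ), ConeChain G Y n x y ℓ ∧ n + ℓ < R := by
  let cost : X → X → Set ℝ := fun x y => {c | ∃ (n : ℕ) (ℓ : ℝ), ConeChain G Y n x y ℓ ∧ n + ℓ = c}
  have hnn : ∀ x y, ∀ c ∈ cost x y, 0 ≤ c := by
    rintro x y _ ⟨n, ℓ, h, rfl⟩
    exact add_nonneg n.cast_nonneg h.nonneg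
  have hbdd : ∀ x y, BddBelow (cost x y) := fun x y => ⟨0, hnn x y⟩
  have hwalk : ∀ x y, dist x y ∈ cost x y := fun x y =>
    ⟨0, dist x y, .walk le_rfl, by simp⟩
  have hsymm : ∀ x y, cost x y ⊆ cost y x := by
    rintro x y _ ⟨n, ℓ, h, rfl⟩
    exact ⟨n, ℓ, h.symm, rfl⟩
  have hle : sInf (cost x y) ≤ dhat x y := by
    refine dhat_max (fun x y => sInf (cost x y)) (fun x => le_antisymm ?_ ?_) (fun x y => ?_)
      (fun x y z => ?_) (fun x y => csInf_le (hbdd x y) (hwalk x y)) (fun g u hu v hv => ?_) x y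
    · exact csInf_le (hbdd x x) (by simpa using hwalk x x)
    · exact le_csInf ⟨_, hwalk x x⟩ (hnn x x)
    · rw [(hsymm x y).antisymm (hsymm y x)]
    · refine le_of_forall_pos_lt_add fun ε hε => ?_
      obtain ⟨_, ⟨n, ℓ, h, rfl⟩, hlt⟩ := exists_lt_of_csInf_lt ⟨_, hwalk x y⟩
        (lt_add_of_pos_right (sInf (cost x y)) (half_pos hε))
      obtain ⟨_, ⟨n', ℓ', h', rfl⟩, hlt'⟩ := exists_lt_of_csInf_lt ⟨_, hwalk y z⟩
        (lt_add_of_pos_right (sInf (cost y z)) (half_pos hε))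
      have := csInf_le (hbdd x z) ⟨_, _, h.trans h', rfl⟩
      push_cast at this
      linarith
    · exact csInf_le (hbdd u v) ⟨1, 0 + 0, .jump g (.walk (dist_self u).le) hu hv (dist_self v).le,
        by norm_num⟩
  obtain ⟨_, ⟨n, ℓ, h, rfl⟩, hlt⟩ := exists_lt_of_csInf_lt ⟨_, hwalk x y⟩ (hle.trans_lt hR)
  exact ⟨n, ℓ, h, hlt⟩

/-- Points close to a geodesic joining the endpoints of a cone chain based in `Y` are close to one
of a bounded number of translates of `Y`. -/
lemma ConeChain.exists_finset_infDist_le [DecidableEq G] {δ : ℝ} (hδ0 : 0 ≤ δ)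
    (hδ : FourPoint X δ) {Y : Set X} {κ : ℝ} (hκ : 0 ≤ κ)
    (hY : ∀ (g : G), ∀ a ∈ g • Y, ∀ b ∈ g • Y, ∀ z, infDist z (g • Y) ≤ gprod z a b + κ)
    {n : ℕ} {x y : X} {ℓ : ℝ} (h : ConeChain G Y n x y ℓ) (hx : x ∈ Y) :
    ∃ T : Finset G, T.card ≤ n + 1 ∧
      ∀ z, ∃ g ∈ T, infDist z (g • Y) ≤ gprod z x y + 2 * δ * n + ℓ + κ := by
  have hnear : ∀ (Z : Set X) (z v w : X), v ∈ Z → infDist z Z ≤ gprod z v w + dist v w :=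
    fun Z z v w hv => by
      linarith [infDist_le_dist_of_mem (x := z) hv, dist_sub_dist_le_gprod z v w]
  induction h with
  | @walk x y ℓ h =>
    refine ⟨{1}, by simp, fun z => ⟨1, by simp, ?_⟩⟩
    rw [one_smul]
    have := hnear Y z x y hx
    push_cast
    linarith
  | @jump n x u v y ℓ ℓ' g hc hu hv hy ih =>
    obtain ⟨T, hT, hTz⟩ := ih hx
    refine ⟨insert g T, (Finset.card_insert_le _ _).trans (by omega), fun z => ?_⟩
    have hℓ := hc.nonneg
    have hℓ' := dist_nonneg.trans hy
    have hnδ : 0 ≤ 2 * δ * n := by positivity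
    push_cast
    have h1 := hδ z x u y
    have h2 := hδ z u v y
    rcases min_le_iff.1 (sub_le_iff_le_add.1 h1) with h | h
    · obtain ⟨g', hg', hz⟩ := hTz z
      exact ⟨g', Finset.mem_insert_of_mem hg', by linarith⟩
    · refine ⟨g, Finset.mem_insert_self _ _, ?_⟩
      rcases min_le_iff.1 (sub_le_iff_le_add.1 h2) with h' | h'
      · linarith [hY g u hu v hv z]
      · linarith [hnear (g • Y) z v y hv]

end ConeOff

section Translates

variable {G X : Type*} [Group G] [MetricSpace X] [MulAction G X]

lemma infDist_le_gprod_add_of_quasiconvex {δ : ℝ} (hδ : FourPoint X δ) (hgeo : IsGeodesicSpace X)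
    {Y : Set X} {K : ℝ}
    (hqc : ∀ a ∈ Y, ∀ b ∈ Y, ∀ γ : ℝ → X, γ 0 = a → γ (dist a b) = b →
      IsGeodesicOn γ (dist a b) → ∀ u ∈ Set.Icc (0:ℝ) (dist a b), infDist (γ u) Y ≤ K)
    {a b : X} (ha : a ∈ Y) (hb : b ∈ Y) (z : X) :
    infDist z Y ≤ gprod z a b + (K + 2 * δ) := by
  obtain ⟨σ, h0, h1, hσ⟩ := hgeo a b
  obtain ⟨v, hv, hz⟩ := exists_dist_geodesic_le hδ h0 h1 hσ z
  linarith [hqc a ha b hb σ h0 h1 hσ v hv, infDist_le_infDist_add_dist (s := Y) (x := z) (y := σ v)]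

lemma infDist_smul_set_of_dist_smul (hiso : ∀ (g : G) (x y : X), dist (g • x) (g • y) = dist x y)
    (g : G) (z : X) (Y : Set X) : infDist (g • z) (g • Y) = infDist z Y := by
  have : Isometry (fun x : X => g • x) := Isometry.of_dist_eq (hiso g)
  exact infDist_image this

/-- Along a quasi-geodesic, being close to a quasi-convex set at two times forces being close to it
at all intermediate times. -/
lemma infDist_le_of_infDist_le {Y : Set X} (hne : Y.Nonempty) {κ M E : ℝ} {x y z : X}
    (hY : ∀ a ∈ Y, ∀ b ∈ Y, infDist z Y ≤ gprod z a b + κ) (hz : gprod z x y ≤ M)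
    (hx : infDist x Y ≤ E) (hy : infDist y Y ≤ E) :
    infDist z Y ≤ M + 2 * (E + 1) + κ := by
  obtain ⟨a, ha, hxa⟩ := (infDist_lt_iff hne).1 (hx.trans_lt (lt_add_one E))
  obtain ⟨b, hb, hyb⟩ := (infDist_lt_iff hne).1 (hy.trans_lt (lt_add_one E))
  linarith [hY a ha b hb, gprod_le_gprod_add_dist_add_dist z x y a b]

end Translates

/-- If every family of translates of `Y` by distinct cosets of `H` satisfying `P` has at most `N`
members, then only finitely many translates of `Y` satisfy `P`. -/
lemma exists_finset_smul_set_eq {G X : Type*} [Group G] [MulAction G X] {H : Subgroup G}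
    {Y : Set X} (hinv : ∀ h ∈ H, h • Y = Y)
    (P : Set X → Prop) (N : ℕ)
    (hN : ∀ T : Finset G, (∀ g ∈ T, ∀ g' ∈ T, g ≠ g' → g⁻¹ * g' ∉ H) →
      (∀ g ∈ T, P (g • Y)) → T.card ≤ N) :
    ∃ F : Finset G, ∀ g : G, P (g • Y) → ∃ g' ∈ F, g • Y = g' • Y := by
  classical
  have hout : ∀ g : G, g • Y = (Quotient.out (g : G ⧸ H)) • Y := by
    intro g
    obtain ⟨h, hh⟩ := QuotientGroup.mk_out_eq_mul H g
    rw [hh, mul_smul, hinv h h.2]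
  have hfin : {q : G ⧸ H | P (q.out • Y)}.Finite := by
    by_contra hinf
    obtain ⟨U, hU, hcard⟩ := Set.Infinite.exists_subset_card_eq hinf (N + 1)
    have := hN (U.image Quotient.out) ?_ ?_
    · rw [Finset.card_image_of_injective _ Quotient.out_injective] at this
      omega
    · intro g hg g' hg' hne hmem
      obtain ⟨q, -, rfl⟩ := Finset.mem_image.1 hg
      obtain ⟨q', -, rfl⟩ := Finset.mem_image.1 hg'
      have := QuotientGroup.eq.2 hmem
      rw [QuotientGroup.out_eq', QuotientGroup.out_eq'] at this
      exact hne (by rw [this])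
    · intro g hg
      obtain ⟨q, hq, rfl⟩ := Finset.mem_image.1 hg
      exact hU hq
  refine ⟨hfin.toFinset.image Quotient.out, fun g hg => ⟨_, Finset.mem_image_of_mem _ ?_, hout g⟩⟩
  exact hfin.mem_toFinset.2 (hout g ▸ hg : P ((Quotient.out (g : G ⧸ H)) • Y))

/-- Lemma 6.10: for an A/QI triple `(G,X,H)` with cone-off metric `dhat`
(obtained by coning the translates of the `H`-cocompact quasi-convex set `Y₀`), any
quasi-geodesic ray of `X` whose image in the cone-off is bounded limits to a point in the
limit set of some conjugate of `H`. -/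
theorem bounded_in_coneoff_implies_limit_in_conjugate
    {G X : Type*} [Group G] [MetricSpace X] [MulAction G X]
    (hiso : ∀ (g : G) (x y : X), dist (g • x) (g • y) = dist x y)
    (δ : ℝ) (hδ : 0 ≤ δ)
    (hhyp : ∀ w x y z : X, min (gprod w x y) (gprod w y z) - δ ≤ gprod w x z)
    (hgeo : IsGeodesicSpace X)
    (x₀ : X) (H : Subgroup G)
    (hHinf : ((H : Set G)).Infinite)
    -- H is finitely generated and quasi-isometrically embedded by the orbit map
    (S : Set G) (hSfin : S.Finite) (hSgen : Subgroup.closure S = H)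
    (C : ℝ) (hC : 1 ≤ C)
    (hqie : ∀ h ∈ H, (wlen S h : ℝ) / C - C ≤ dist (h • x₀) x₀ ∧
      dist (h • x₀) x₀ ≤ C * (wlen S h) + C)
    -- Y₀ is an H-invariant, H-cobounded, K-quasi-convex subset containing x₀
    (Y₀ : Set X) (hx₀Y₀ : x₀ ∈ Y₀) (hY₀inv : ∀ h ∈ H, h • Y₀ = Y₀)
    (hY₀cobdd : ∃ r : ℝ, 0 ≤ r ∧ ∀ y ∈ Y₀, ∃ h ∈ H, dist y (h • x₀) ≤ r)
    (K : ℝ) (hK : 0 ≤ K)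
    (hY₀qc : ∀ a ∈ Y₀, ∀ b ∈ Y₀, ∀ γ : ℝ → X, γ 0 = a → γ (dist a b) = b →
      (∀ s ∈ Set.Icc (0:ℝ) (dist a b), ∀ t ∈ Set.Icc (0:ℝ) (dist a b),
        dist (γ s) (γ t) = |s - t|) →
      ∀ u ∈ Set.Icc (0:ℝ) (dist a b), infDist (γ u) Y₀ ≤ K)
    -- acylindricity along the translates of Y₀
    (hacyl : ∀ ε : ℝ, 0 ≤ ε → ∃ D : ℝ, ∃ N : ℕ,
      ∀ T : Finset G,
        (∀ g ∈ T, ∀ g' ∈ T, g ≠ g' → g⁻¹ * g' ∉ H) →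
        (∃ z w : X, (∀ g ∈ T, infDist z (g • Y₀) ≤ ε ∧ infDist w (g • Y₀) ≤ ε) ∧
          D < dist z w) →
        T.card ≤ N)
    -- dhat is the cone-off (pseudo)metric: the largest pseudometric dominated by dist that
    -- gives diameter ≤ 1 to every translate of Y₀
    (dhat : X → X → ℝ)
    (dhat_self : ∀ x : X, dhat x x = 0)
    (dhat_symm : ∀ x y : X, dhat x y = dhat y x)
    (dhat_tri : ∀ x y z : X, dhat x z ≤ dhat x y + dhat y z)
    (dhat_le : ∀ x y : X, dhat x y ≤ dist x y)
    (dhat_cone : ∀ (g : G), ∀ u ∈ g • Y₀, ∀ v ∈ g • Y₀, dhat u v ≤ 1)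
    (dhat_max : ∀ ρ : X → X → ℝ, (∀ x, ρ x x = 0) → (∀ x y, ρ x y = ρ y x) →
      (∀ x y z, ρ x z ≤ ρ x y + ρ y z) → (∀ x y, ρ x y ≤ dist x y) →
      (∀ (g : G), ∀ u ∈ g • Y₀, ∀ v ∈ g • Y₀, ρ u v ≤ 1) →
      ∀ x y, ρ x y ≤ dhat x y)
    -- γ is a τ₀-quasi-geodesic ray in X
    (τ₀ : ℝ) (hτ₀ : 1 ≤ τ₀) (γ : ℝ → X) (hγ0 : γ 0 = x₀)
    (hγ : ∀ s ∈ Set.Ici (0:ℝ), ∀ t ∈ Set.Ici (0:ℝ),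
      τ₀⁻¹ * |s - t| - τ₀ ≤ dist (γ s) (γ t) ∧ dist (γ s) (γ t) ≤ τ₀ * |s - t| + τ₀)
    -- whose image in the cone-off is bounded
    (hbdd : ∃ Cb : ℝ, ∀ s ∈ Set.Ici (0:ℝ), ∀ t ∈ Set.Ici (0:ℝ), dhat (γ s) (γ t) ≤ Cb) :
    -- conclusion: γ limits to a point of Λ(gHg⁻¹) for some g
    ∃ g₀ : G, ∃ k : ℕ → G, (∀ n, k n ∈ H) ∧
      ∀ N : ℝ, ∃ m : ℕ, ∀ n : ℕ, m ≤ n →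
        N ≤ gprod x₀ (γ n) ((g₀ * k n * g₀⁻¹) • x₀) := by
  classical
  have hqg : IsQuasiGeodesicRay τ₀ γ := hγ
  obtain ⟨M, hM0, hM⟩ := exists_forall_gprod_quasiGeodesic_le hδ hhyp hgeo hτ₀
  have hne : ∀ g : G, (g • Y₀).Nonempty := fun g => ⟨_, Set.smul_mem_smul_set hx₀Y₀⟩
  set κ := K + 2 * δ with hκdef
  have hκ : 0 ≤ κ := by positivity
  have hY : ∀ (g : G), ∀ a ∈ g • Y₀, ∀ b ∈ g • Y₀, ∀ z,
      infDist z (g • Y₀) ≤ gprod z a b + κ := by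
    rintro g _ ⟨a, ha, rfl⟩ _ ⟨b, hb, rfl⟩ z
    have h := infDist_le_gprod_add_of_quasiconvex hhyp hgeo hY₀qc ha hb (g⁻¹ • z)
    rw [← infDist_smul_set_of_dist_smul hiso g, smul_inv_smul] at h
    unfold gprod at h ⊢
    rw [← hiso g (g⁻¹ • z) a, ← hiso g (g⁻¹ • z) b, ← hiso g a b, smul_inv_smul] at h
    exact h
  have hbetween : ∀ (g : G) (E t u s : ℝ), 0 ≤ t → t ≤ u → u ≤ s →
      infDist (γ t) (g • Y₀) ≤ E → infDist (γ s) (g • Y₀) ≤ E →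
      infDist (γ u) (g • Y₀) ≤ M + 2 * (E + 1) + κ := fun g E t u s ht htu hus h1 h2 =>
    infDist_le_of_infDist_le (hne g) (fun a ha b hb => hY g a ha b hb _)
      (hM γ hqg t u s ht htu hus) h1 h2
  obtain ⟨R, hR⟩ := hbdd
  set E := M + 2 * δ * (R + 1) + (R + 1) + κ with hE
  have hR0 : 0 ≤ R := by simpa [dhat_self] using hR 0 Set.self_mem_Ici 0 Set.self_mem_Ici
  have hE0 : 0 ≤ E := by positivity
  obtain ⟨m, hm⟩ := exists_nat_gt (R + 1)
  have hcover : ∀ s, 0 ≤ s → ∃ T : Finset G, T.card ≤ m ∧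
      ∀ u, 0 ≤ u → u ≤ s → ∃ g ∈ T, infDist (γ u) (g • Y₀) ≤ E := by
    intro s hs
    obtain ⟨n, ℓ, hchain, hcost⟩ := exists_coneChain_of_lt dhat_max (x := γ 0) (y := γ s)
      ((hR 0 Set.self_mem_Ici s hs).trans_lt (lt_add_one R))
    have hℓ := hchain.nonneg
    obtain ⟨T, hT, hTz⟩ := hchain.exists_finset_infDist_le hδ hhyp hκ hY (hγ0 ▸ hx₀Y₀)
    have hnm : n < m := by exact_mod_cast (by linarith : (n:ℝ) < m)
    refine ⟨T, by omega, fun u hu hus => ?_⟩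
    obtain ⟨g, hg, hgz⟩ := hTz (γ u)
    refine ⟨g, hg, hgz.trans ?_⟩
    have := hM γ hqg 0 u s le_rfl hu hus
    have : 2 * δ * n ≤ 2 * δ * (R + 1) := by gcongr; linarith
    linarith
  set E₂ := M + 2 * (E + 1) + κ with hE₂
  obtain ⟨t, ht, hts⟩ : ∃ t, 0 ≤ t ∧ ∀ s, t ≤ s → ∃ g : G,
      infDist (γ t) (g • Y₀) ≤ E₂ ∧ infDist (γ s) (g • Y₀) ≤ E₂ := by
    by_contra! hcon
    choose! f hf hfar using hcon
    let q : ℕ → ℝ := fun i => f^[i] 0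
    have hqs : ∀ i, q (i + 1) = f (q i) := fun i => Function.iterate_succ_apply' f i 0
    have hq0 : ∀ i, 0 ≤ q i := by
      intro i
      induction i with
      | zero => exact le_rfl
      | succ i ih => rw [hqs]; exact ih.trans (hf _ ih)
    have hmono : Monotone q := monotone_nat_of_le_succ fun i => by
      rw [hqs]; exact hf _ (hq0 i)
    obtain ⟨T, hT, hTz⟩ := hcover (q m) (hq0 m)
    have hex : ∀ i, i ≤ m → ∃ g ∈ T, infDist (γ (q i)) (g • Y₀) ≤ E := fun i hi =>
      hTz _ (hq0 i) (hmono hi)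
    choose! c hcT hc using hex
    have hpair : ∀ i j, i ≤ m → j ≤ m → i < j → c i ≠ c j := by
      intro i j hi hj hij heq
      have hb := hbetween (c i) E (q i) (q (i + 1)) (q j) (hq0 i) (hmono (by omega))
        (hmono (by omega)) (hc i hi) (heq ▸ hc j hj)
      have ha : infDist (γ (q i)) (c i • Y₀) ≤ E₂ := by linarith [hc i hi]
      have := hfar (q i) (hq0 i) (c i) ha
      rw [← hqs] at this
      linarith
    obtain ⟨i, hi, j, hj, hij, heq⟩ := Finset.exists_ne_map_eq_of_card_lt_of_maps_to
      (s := Finset.range (m + 1)) (t := T) (f := c) (by simpa using by omega)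
      (fun i hi => hcT i (by simpa [Nat.lt_succ_iff] using hi))
    have hi' : i ≤ m := by simpa [Nat.lt_succ_iff] using hi
    have hj' : j ≤ m := by simpa [Nat.lt_succ_iff] using hj
    rcases hij.lt_or_gt with h | h
    · exact hpair i j hi' hj' h heq
    · exact hpair j i hj' hi' h heq.symm
  set E₃ := M + 2 * (E₂ + 1) + κ with hE₃
  have hE₃0 : 0 ≤ E₃ := by positivity
  have hE₂₃ : E₂ ≤ E₃ := by
    have : 0 ≤ E₂ := by positivity
    linarith
  obtain ⟨D, N, hDN⟩ := hacyl E₃ hE₃0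
  obtain ⟨s₁, hts₁, hs₁⟩ : ∃ s₁, t ≤ s₁ ∧ D < dist (γ t) (γ s₁) := by
    have hpos : 0 ≤ τ₀ * (|D| + 1 + τ₀) := by positivity
    refine ⟨t + τ₀ * (|D| + 1 + τ₀), by linarith, ?_⟩
    have h := (hγ t ht _ (show (0:ℝ) ≤ t + τ₀ * (|D| + 1 + τ₀) by linarith)).1
    rw [sub_add_cancel_left, abs_neg, abs_of_nonneg hpos,
      inv_mul_cancel_left₀ (by linarith)] at h
    linarith [le_abs_self D]
  obtain ⟨F, hF⟩ := exists_finset_smul_set_eq (H := H) hY₀inv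
    (fun Z => infDist (γ t) Z ≤ E₃ ∧ infDist (γ s₁) Z ≤ E₃) N
    (fun T hT hP => hDN T hT ⟨γ t, γ s₁, hP, hs₁⟩)
  have hfin : ∀ n : ℕ, ∃ g : F,
      infDist (γ t) ((g : G) • Y₀) ≤ E₂ ∧ infDist (γ (s₁ + n)) ((g : G) • Y₀) ≤ E₂ := by
    intro n
    have hn : (0:ℝ) ≤ n := n.cast_nonneg
    obtain ⟨g, hg1, hg2⟩ := hts (s₁ + n) (by linarith)
    obtain ⟨g', hg', heq⟩ := hF g ⟨hg1.trans hE₂₃,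
      hbetween g E₂ t s₁ (s₁ + n) ht hts₁ (by linarith) hg1 hg2⟩
    exact ⟨⟨g', hg'⟩, heq ▸ hg1, heq ▸ hg2⟩
  choose c hc1 hc2 using hfin
  obtain ⟨⟨g, hgF⟩, hginf⟩ := Finite.exists_infinite_fiber c
  have hray : ∀ u, t ≤ u → infDist (γ u) (g • Y₀) ≤ E₃ := by
    intro u hu
    obtain ⟨m₁, hm₁⟩ := exists_nat_gt (u - s₁)
    obtain ⟨n, hn, hmn⟩ := (Set.infinite_coe_iff.1 hginf).exists_gt m₁
    have hcn : c n = ⟨g, hgF⟩ := hn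
    have h1 := hc1 n
    have h2 := hc2 n
    rw [hcn] at h1 h2
    have hmn' : (m₁:ℝ) < n := by exact_mod_cast hmn
    exact hbetween g E₂ t u (s₁ + n) ht hu (by linarith) h1 h2
  obtain ⟨r, hr0, hr⟩ := hY₀cobdd
  have hk : ∀ n : ℕ, ∃ k ∈ H, t ≤ n → dist (γ n) ((g * k) • x₀) ≤ E₃ + 1 + r := by
    intro n
    by_cases htn : t ≤ n
    · obtain ⟨_, ⟨y, hy, rfl⟩, hd⟩ := (infDist_lt_iff (hne g)).1
        ((hray n htn).trans_lt (lt_add_one E₃))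
      obtain ⟨k, hkH, hky⟩ := hr y hy
      refine ⟨k, hkH, fun _ => ?_⟩
      rw [mul_smul]
      rw [← hiso g] at hky
      exact (dist_triangle _ _ _).trans (add_le_add hd.le hky)
    · exact ⟨1, H.one_mem, fun h => absurd h htn⟩
  choose k hkH hkd using hk
  refine ⟨g, k, hkH, fun B => ?_⟩
  obtain ⟨m₂, hm₂⟩ := exists_nat_ge
    (max t (τ₀ * (B + τ₀ + (E₃ + 1 + r) + dist x₀ (g⁻¹ • x₀))))
  refine ⟨m₂, fun n hn => ?_⟩
  have hn' : (m₂:ℝ) ≤ n := by exact_mod_cast hn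
  have hd := hkd n ((le_max_left _ _).trans (hm₂.trans hn'))
  have hlarge := (le_max_right _ _).trans (hm₂.trans hn')
  have hq := (hγ 0 Set.self_mem_Ici n (Set.mem_Ici.2 n.cast_nonneg)).1
  rw [zero_sub, abs_neg, abs_of_nonneg n.cast_nonneg, hγ0] at hq
  rw [← le_inv_mul_iff₀ (by linarith)] at hlarge
  have htri := dist_triangle (γ n) ((g * k n) • x₀) ((g * k n * g⁻¹) • x₀)
  rw [mul_smul (g * k n) g⁻¹, hiso] at htri
  have := dist_sub_dist_le_gprod x₀ (γ n) ((g * k n * g⁻¹) • x₀)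
  rw [mul_smul (g * k n) g⁻¹] at this ⊢
  linarith
end
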